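/- Let η be the Markov chain on ℤ with transition kernel P and let θ₀ := min{n ≥ 1 : η(n) = 0} be the first return time to 0. Then there exists γ > 0 such that E[exp(γ·θ₀) | η(0) = 0] < ∞. -/

import Mathlib

open MeasureTheory Filter
open scoped BigOperators ENNReal

noncomputable section

/-- `p(x) = w(-x)/(w(x)+w(-x))`. -/
def pfun (w : ℤ → ℝ) (x : ℤ) : ℝ := w (-x) / (w x + w (-x))

/-- `q(x) = w(x)/(w(x)+w(-x))`. -/
def qfun (w : ℤ → ℝ) (x : ℤ) : ℝ := w x / (w x + w (-x))

/-- The Markov transition kernel `P(x,y)`. -/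
def Pker (w : ℤ → ℝ) (x y : ℤ) : ℝ :=
  if x - 1 ≤ y then (∏ z ∈ Finset.Icc x y, pfun w z) * qfun w (y + 1) else 0

/-- The `m`-step transition kernel. -/
def Pm (w : ℤ → ℝ) : ℕ → ℤ → ℤ → ℝ
  | 0, x, y => if x = y then 1 else 0
  | m + 1, x, y => ∑' z : ℤ, Pm w m x z * Pker w z y

/-- The normalizing constant `Z`. -/
def Zconst (w : ℤ → ℝ) : ℝ :=
  2 * ∑' x : ℕ, ∏ z ∈ Finset.Icc (1 : ℤ) (x : ℤ), w (-z) / w z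

/-- The stationary distribution `ρ`. -/
def rho (w : ℤ → ℝ) (x : ℤ) : ℝ :=
  (Zconst w)⁻¹ * ∏ z ∈ Finset.Icc (1 : ℤ) (|2 * x + 1| / 2), w (-z) / w z

/-- The weight function `w` is positive, nondecreasing and satisfies
`lim_{z→∞} (w(z) - w(-z)) > 0`. -/
def GoodWeight (w : ℤ → ℝ) : Prop :=
  (∀ z, 0 < w z) ∧ (∀ z, w z ≤ w (z + 1)) ∧
    ∃ c > (0 : ℝ), ∀ᶠ z : ℤ in atTop, c ≤ w z - w (-z)

/-- `η` is a Markov chain with (sub)stochastic kernel `K` started at `a`,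
characterized through its cylinder probabilities. -/
def KChain {Ω : Type*} [MeasurableSpace Ω] (μ : Measure Ω)
    (K : ℤ → ℤ → ℝ) (η : ℕ → Ω → ℤ) (a : ℤ) : Prop :=
  (∀ n, Measurable (η n)) ∧
  ∀ (n : ℕ) (x : ℕ → ℤ),
    μ {ω | ∀ i ≤ n, η i ω = x i} =
      ENNReal.ofReal ((if x 0 = a then (1 : ℝ) else 0) *
        ∏ i ∈ Finset.range n, K (x i) (x (i + 1)))

/-- A radial Lyapunov profile: increasing, concave enough near the origin and of small exponential
growth at infinity. -/
lemma exists_radial_profile (r : ℕ → ℝ) (N : ℕ) (ρ : ℝ) (hρ : 0 < ρ) (hρ1 : ρ < 1)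
    (hr : ∀ v, r v ≤ 1) (hrN : ∀ v, N ≤ v → r v ≤ ρ) :
    ∃ s > (1 : ℝ), ∃ F : ℕ → ℝ, (∀ v, 1 ≤ F v) ∧ F 1 ≤ 2 * F 0 ∧ (∀ v, F v ≤ F (v + 1)) ∧
      ∀ v, r v * (F (v + 2) - F (v + 1)) + (s - 1) * F (v + 2) ≤ F (v + 1) - F v := by
  obtain ⟨t, ht1, htρ⟩ : ∃ t : ℝ, 1 < t ∧ ρ * t < 1 := by
    refine ⟨2 / (1 + ρ), ?_, ?_⟩
    · rw [lt_div_iff₀ (by linarith)]; linarith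
    · rw [mul_div_assoc', div_lt_one (by linarith)]; linarith
  have ht : 0 < t := by linarith
  set D : ℕ → ℝ := fun j => t ^ j * ρ ^ (min j N) with hD
  have hDpos : ∀ j, 0 < D j := fun j => by positivity
  have hDle : ∀ j, D j ≤ t ^ j := fun j =>
    mul_le_of_le_one_right (by positivity) (pow_le_one₀ hρ.le hρ1.le)
  have hDge : ∀ j, ρ ^ N * t ^ j ≤ D j := fun j => by
    rw [mul_comm]
    exact mul_le_mul_of_nonneg_left
      (pow_le_pow_of_le_one hρ.le hρ1.le (min_le_right _ _)) (by positivity)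
  have hstep : ∀ v, r v * D (v + 1) ≤ ρ * t * D v := fun v => by
    rcases lt_or_ge v N with h | h
    · have e : D (v + 1) = ρ * t * D v := by
        simp only [hD]
        rw [min_eq_left (by omega), min_eq_left (by omega)]; ring
      rw [← e]
      exact mul_le_of_le_one_left (hDpos _).le (hr v)
    · have e : D (v + 1) = t * D v := by
        simp only [hD]
        rw [min_eq_right (by omega), min_eq_right (by omega)]; ring
      rw [e, ← mul_assoc]
      have := hrN v h
      have := hDpos v
      gcongr
  set F : ℕ → ℝ := fun v => 1 + ∑ j ∈ Finset.range v, D j with hF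
  have hFs : ∀ v, F (v + 1) = F v + D v := fun v => by
    simp only [hF, Finset.sum_range_succ]; ring
  set K : ℝ := t / (t - 1) with hK
  have ht' : 0 < t - 1 := by linarith
  have hKpos : 0 < K := by positivity
  have hK1 : 1 ≤ K := by rw [hK, le_div_iff₀ ht']; linarith
  have hKt : K * (t - 1) = t := by rw [hK]; field_simp
  have hFle : ∀ v, F v ≤ K * t ^ v := fun v => by
    induction v with
    | zero => simpa [hF] using hK1
    | succ v ih =>
      rw [hFs, pow_succ]
      have h1 := hDle v
      have h2 : 0 < t ^ v := by positivity
      have h3 : K * (t ^ v * t) = K * t ^ v + t * t ^ v := by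
        linear_combination t ^ v * hKt
      nlinarith
  refine ⟨1 + (1 - ρ * t) * ρ ^ N / (K * t ^ 2), ?_, F, ?_, ?_, ?_, ?_⟩
  · have : 0 < 1 - ρ * t := by linarith
    have : 0 < (1 - ρ * t) * ρ ^ N / (K * t ^ 2) := by positivity
    linarith
  · intro v
    have : 0 ≤ ∑ j ∈ Finset.range v, D j := Finset.sum_nonneg fun j _ => (hDpos j).le
    simp only [hF]; linarith
  · simp [hF, hD]; norm_num
  · intro v; rw [hFs]; linarith [hDpos v]
  · intro v
    have h1 : (1 - ρ * t) * ρ ^ N / (K * t ^ 2) * F (v + 2) ≤ (1 - ρ * t) * D v := by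
      have h0 : 0 < 1 - ρ * t := by linarith
      calc (1 - ρ * t) * ρ ^ N / (K * t ^ 2) * F (v + 2)
          ≤ (1 - ρ * t) * ρ ^ N / (K * t ^ 2) * (K * t ^ (v + 2)) := by
            gcongr; exact hFle _
        _ = (1 - ρ * t) * (ρ ^ N * t ^ v) := by rw [pow_add]; field_simp
        _ ≤ _ := by gcongr; exact hDge v
    have h2 := hstep v
    have e1 := hFs v
    have e2 := hFs (v + 1)
    have e3 : F (v + 2) - F (v + 1) = D (v + 1) := by rw [show v + 2 = v + 1 + 1 from rfl, e2]; ring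
    rw [e3, e1, add_sub_cancel_left]
    linarith

lemma pfun_pos {w : ℤ → ℝ} (hw : ∀ z, 0 < w z) (x : ℤ) : 0 < pfun w x :=
  div_pos (hw _) (add_pos (hw _) (hw _))

lemma qfun_pos {w : ℤ → ℝ} (hw : ∀ z, 0 < w z) (x : ℤ) : 0 < qfun w x :=
  div_pos (hw _) (add_pos (hw _) (hw _))

lemma pfun_add_qfun {w : ℤ → ℝ} (hw : ∀ z, 0 < w z) (x : ℤ) : pfun w x + qfun w x = 1 := by
  have h1 := hw x
  have h2 := hw (-x)
  unfold pfun qfun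
  field_simp
  ring

lemma Pker_nonneg {w : ℤ → ℝ} (hw : ∀ z, 0 < w z) (x y : ℤ) : 0 ≤ Pker w x y := by
  unfold Pker
  split_ifs
  · exact mul_nonneg (Finset.prod_nonneg fun z _ => (pfun_pos hw z).le) (qfun_pos hw _).le
  · exact le_rfl

lemma Pker_sub_one (w : ℤ → ℝ) (x : ℤ) : Pker w x (x - 1) = qfun w x := by
  simp [Pker]

lemma Pker_eq_mul (w : ℤ → ℝ) {x y : ℤ} (h : x ≤ y) :
    Pker w x y = pfun w x * Pker w (x + 1) y := by
  have e : Finset.Icc x y = insert x (Finset.Icc (x + 1) y) := by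
    ext z; simp only [Finset.mem_insert, Finset.mem_Icc]; omega
  rw [Pker, Pker, if_pos (by omega), if_pos (by omega), e, Finset.prod_insert (by simp), mul_assoc]

/-- A supersolution for the birth-death chain whose down-steps drive `P`. -/
lemma exists_supersolution {w : ℤ → ℝ} (hw : GoodWeight w) :
    ∃ s > (1 : ℝ), ∃ f : ℤ → ℝ, (∀ x, 1 ≤ f x) ∧
      ∀ x, s * (qfun w x * if x - 1 = 0 then 0 else f (x - 1)) + pfun w x * f (x + 1) ≤ f x := by
  obtain ⟨hpos, hsucc, c, hc, hev⟩ := hw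
  have hmono : Monotone w := monotone_int_of_le_succ hsucc
  obtain ⟨M, hM⟩ := hev.exists_forall_of_atTop
  set N := M.toNat
  have hN : w (-(N : ℤ)) < w N := by
    have := hM N (Int.self_le_toNat M)
    linarith
  obtain ⟨s, hs, F, hF1, hF01, hFm, hF⟩ := exists_radial_profile
    (fun v : ℕ => w (-(v : ℤ)) / w v) N (w (-(N : ℤ)) / w N) (div_pos (hpos _) (hpos _))
    ((div_lt_one (hpos _)).2 hN)
    (fun v => (div_le_one (hpos _)).2 (hmono (by omega)))
    (fun v hv => div_le_div₀ (hpos _).le (hmono (by omega)) (hpos _) (hmono (by omega)))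
  refine ⟨s, hs, fun x => F (x - 1).natAbs, fun x => hF1 _, fun x => ?_⟩
  have hp := pfun_pos hpos x
  have hq := qfun_pos hpos x
  have hpq := pfun_add_qfun hpos x
  rcases lt_trichotomy x 1 with hx | rfl | hx
  · obtain ⟨v, rfl⟩ : ∃ v : ℕ, x = -(v : ℤ) := ⟨(-x).toNat, by omega⟩
    beta_reduce
    rw [if_neg (by omega), show (-(v : ℤ) - 1 - 1).natAbs = v + 2 by omega,
      show (-(v : ℤ) - 1).natAbs = v + 1 by omega, show (-(v : ℤ) + 1 - 1).natAbs = v by omega]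
    have e : pfun w (-v) * (w (-(v : ℤ)) / w v) = qfun w (-v) := by
      have h1 := hpos v
      have h2 := hpos (-v)
      simp only [pfun, qfun, neg_neg]
      field_simp
    have hle : qfun w (-v) ≤ pfun w (-v) := by
      simp only [pfun, qfun, neg_neg]
      have h1 := hpos v
      have h2 := hpos (-v)
      have : w (-(v : ℤ)) ≤ w v := hmono (by omega)
      gcongr
    have h := mul_le_mul_of_nonneg_left (hF v) hp.le
    rw [mul_add, ← mul_assoc, e] at h
    have h3 : qfun w (-v) * ((s - 1) * F (v + 2)) ≤ pfun w (-v) * ((s - 1) * F (v + 2)) :=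
      mul_le_mul_of_nonneg_right hle (mul_nonneg (by linarith) (by linarith [hF1 (v + 2)]))
    have h4 : (pfun w (-v) + qfun w (-v)) * F (v + 1) = F (v + 1) := by rw [hpq, one_mul]
    linarith
  · have hle : pfun w 1 ≤ qfun w 1 := by
      unfold pfun qfun
      have h1 := hpos 1
      have h2 := hpos (-1)
      have : w (-1) ≤ w 1 := hmono (by omega)
      gcongr
    have h0 : 0 ≤ F 0 := by linarith [hF1 0]
    have h1 : 0 ≤ F 1 := by linarith [hF1 1]
    simp
    nlinarith
  · obtain ⟨v, rfl⟩ : ∃ v : ℕ, x = (v : ℤ) + 2 := ⟨(x - 2).toNat, by omega⟩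
    beta_reduce
    rw [if_neg (by omega), show ((v : ℤ) + 2 - 1 - 1).natAbs = v by omega,
      show ((v : ℤ) + 2 - 1).natAbs = v + 1 by omega,
      show ((v : ℤ) + 2 + 1 - 1).natAbs = v + 2 by omega]
    have e : qfun w (v + 2) * (w (-(v + 2 : ℤ)) / w (v + 2)) = pfun w (v + 2) := by
      have h1 := hpos (v + 2)
      have h2 := hpos (-(v + 2))
      unfold pfun qfun
      field_simp
    have hle : pfun w (v + 2) ≤ qfun w (v + 2) * (w (-(v : ℤ)) / w v) := by
      rw [← e]
      exact mul_le_mul_of_nonneg_left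
        (div_le_div₀ (hpos _).le (hmono (by omega)) (hpos _) (hmono (by omega))) hq.le
    have h := mul_le_mul_of_nonneg_left (hF v) hq.le
    rw [mul_add, ← mul_assoc] at h
    have h3 := mul_le_mul_of_nonneg_right hle (sub_nonneg.2 (hFm (v + 1)))
    have h4 : (pfun w (v + 2) + qfun w (v + 2)) * F (v + 1) = F (v + 1) := by rw [hpq, one_mul]
    have h5 : qfun w (v + 2) * ((s - 1) * F v) ≤ qfun w (v + 2) * ((s - 1) * F (v + 2)) :=
      mul_le_mul_of_nonneg_left (mul_le_mul_of_nonneg_left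
        ((hFm v).trans (hFm (v + 1))) (by linarith)) hq.le
    linarith

/-- Supersolutions of the birth-death recursion contract under the kernel `P` killed at `0`. -/
lemma tsum_Pker_le {w : ℤ → ℝ} (hw : ∀ z, 0 < w z) {s : ℝ} (hs : 0 < s) {f : ℤ → ℝ}
    (hf : ∀ x, 0 ≤ f x)
    (hsup : ∀ x, s * (qfun w x * if x - 1 = 0 then 0 else f (x - 1)) + pfun w x * f (x + 1) ≤ f x)
    (x : ℤ) :
    ∑' y : ℤ, ENNReal.ofReal (Pker w x y * if y = 0 then 0 else f y) ≤ ENNReal.ofReal (f x / s) := by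
  have hfin : ∀ (n : ℕ) (x : ℤ), ∑ i ∈ Finset.range n,
      Pker w x (x - 1 + i) * (if x - 1 + i = 0 then 0 else f (x - 1 + i)) ≤ f x / s := by
    intro n
    induction n with
    | zero => intro x; simpa using div_nonneg (hf x) hs.le
    | succ n ih =>
      intro x
      have e : ∑ i ∈ Finset.range n, Pker w x (x - 1 + (i + 1 : ℕ)) *
            (if x - 1 + (i + 1 : ℕ) = 0 then 0 else f (x - 1 + (i + 1 : ℕ))) =
          pfun w x * ∑ i ∈ Finset.range n, Pker w (x + 1) (x + 1 - 1 + i) *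
            (if x + 1 - 1 + i = 0 then 0 else f (x + 1 - 1 + i)) := by
        rw [Finset.mul_sum]
        refine Finset.sum_congr rfl fun i _ => ?_
        rw [show x - 1 + (i + 1 : ℕ) = x + 1 - 1 + (i : ℤ) by push_cast; ring,
          Pker_eq_mul w (by omega), mul_assoc]
      rw [Finset.sum_range_succ', e, Nat.cast_zero, add_zero, Pker_sub_one, le_div_iff₀ hs]
      have h1 := mul_le_mul_of_nonneg_left (ih (x + 1)) (pfun_pos hw x).le
      have h2 := mul_le_mul_of_nonneg_right h1 hs.le
      rw [mul_assoc _ (f (x + 1) / s), div_mul_cancel₀ _ hs.ne'] at h2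
      linarith [hsup x]
  have hinj : Function.Injective fun i : ℕ => x - 1 + (i : ℤ) := fun a b h => by
    simpa using h
  have hsupp : Function.support
      (fun y : ℤ => ENNReal.ofReal (Pker w x y * if y = 0 then 0 else f y)) ⊆
      Set.range fun i : ℕ => x - 1 + (i : ℤ) := by
    intro y hy
    by_contra hne
    refine hy ?_
    have : ¬ x - 1 ≤ y := fun h => hne ⟨(y - (x - 1)).toNat, by simp only; omega⟩
    simp [Pker, this]
  rw [← hinj.tsum_eq hsupp]
  refine ENNReal.tsum_le_of_sum_range_le fun n => ?_
  rw [← ENNReal.ofReal_sum_of_nonneg]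
  · exact ENNReal.ofReal_le_ofReal (hfin n x)
  · intro i _
    refine mul_nonneg (Pker_nonneg hw _ _) ?_
    split_ifs
    · exact le_rfl
    · exact hf _

/-- Geometric bound for avoiding `0` during `k` steps after a prescribed initial path. -/
lemma measure_avoid_le {Ω : Type*} [MeasurableSpace Ω] {μ : Measure Ω} {w : ℤ → ℝ}
    {η : ℕ → Ω → ℤ} (hη : KChain μ (Pker w) η 0) (hw : ∀ z, 0 < w z) {s : ℝ} (hs : 0 < s)
    {f : ℤ → ℝ} (hf : ∀ x, 1 ≤ f x)
    (hP : ∀ x, ∑' y : ℤ, ENNReal.ofReal (Pker w x y * if y = 0 then 0 else f y) ≤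
      ENNReal.ofReal (f x / s)) (k n : ℕ) (x : ℕ → ℤ) :
    μ {ω | (∀ i ≤ n, η i ω = x i) ∧ ∀ m, n < m → m ≤ n + k → η m ω ≠ 0} ≤
      μ {ω | ∀ i ≤ n, η i ω = x i} * ENNReal.ofReal (f (x n) / s ^ k) := by
  induction k generalizing n x with
  | zero =>
    rw [pow_zero, div_one]
    refine (measure_mono fun ω h => h.1).trans (le_mul_of_one_le_right' ?_)
    rw [← ENNReal.ofReal_one]
    exact ENNReal.ofReal_le_ofReal (hf _)
  | succ k ih =>
    set ext : ℤ → ℕ → ℤ := fun y => Function.update x (n + 1) y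
    have hext : ∀ y i, i ≤ n → ext y i = x i := fun y i hi =>
      Function.update_of_ne (by omega) _ _
    have hext' : ∀ y, ext y (n + 1) = y := fun y => Function.update_self _ _ _
    have hcyl : ∀ y, μ {ω | ∀ i ≤ n + 1, η i ω = ext y i} =
        μ {ω | ∀ i ≤ n, η i ω = x i} * ENNReal.ofReal (Pker w (x n) y) := fun y => by
      rw [hη.2, hη.2, Finset.prod_range_succ, ← mul_assoc, hext', hext y n le_rfl,
        hext y 0 n.zero_le, ENNReal.ofReal_mul' (Pker_nonneg hw _ _)]
      congr 3
      refine Finset.prod_congr rfl fun i hi => ?_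
      have := Finset.mem_range.1 hi
      rw [hext y i (by omega), hext y (i + 1) (by omega)]
    have hsub : {ω | (∀ i ≤ n, η i ω = x i) ∧ ∀ m, n < m → m ≤ n + (k + 1) → η m ω ≠ 0} ⊆
        ⋃ y : ℤ, {ω | y ≠ 0 ∧ (∀ i ≤ n + 1, η i ω = ext y i) ∧
          ∀ m, n + 1 < m → m ≤ n + 1 + k → η m ω ≠ 0} := by
      rintro ω ⟨h1, h2⟩
      refine Set.mem_iUnion.2 ⟨η (n + 1) ω, h2 _ (by omega) (by omega), fun i hi => ?_,
        fun m hm hm' => h2 m (by omega) (by omega)⟩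
      rcases Nat.lt_or_ge n i with h | h
      · obtain rfl : i = n + 1 := by omega
        rw [hext']
      · rw [hext _ _ h, h1 i h]
    calc _ ≤ ∑' y : ℤ, μ {ω | y ≠ 0 ∧ (∀ i ≤ n + 1, η i ω = ext y i) ∧
          ∀ m, n + 1 < m → m ≤ n + 1 + k → η m ω ≠ 0} :=
          (measure_mono hsub).trans (measure_iUnion_le _)
      _ ≤ ∑' y : ℤ, μ {ω | ∀ i ≤ n, η i ω = x i} *
          (ENNReal.ofReal (Pker w (x n) y * if y = 0 then 0 else f y) *
            ENNReal.ofReal (1 / s ^ k)) := by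
          refine ENNReal.tsum_le_tsum fun y => ?_
          by_cases hy : y = 0
          · simp [hy]
          · simp only [ne_eq, hy, not_false_eq_true, true_and, if_false]
            refine (ih (n + 1) (ext y)).trans (le_of_eq ?_)
            rw [hcyl, hext', ENNReal.ofReal_mul (Pker_nonneg hw _ _), div_eq_mul_one_div,
              ENNReal.ofReal_mul (by linarith [hf y])]
            ring
      _ ≤ _ := by
          rw [ENNReal.tsum_mul_left, ENNReal.tsum_mul_right]
          refine mul_le_mul_right ?_ _
          refine (mul_le_mul_left (hP _) _).trans (le_of_eq ?_)
          rw [← ENNReal.ofReal_mul (div_nonneg (by linarith [hf (x n)]) hs.le), pow_succ]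
          congr 1
          field_simp

/-- the first return time `θ₀ := min{n ≥ 1 : η(n) = 0}` of the Markov chain `η`
with kernel `P` started at `0` has a finite exponential moment.  The expectation
`E[exp(γ θ₀)]` is written as `∑_n e^{γn} Pr(θ₀ = n) + ∞ · Pr(θ₀ = ∞)` in `ℝ≥0∞`. -/
theorem stmt_5 (w : ℤ → ℝ) (hw : GoodWeight w)
    {Ω : Type*} [MeasurableSpace Ω] (μ : Measure Ω) [IsProbabilityMeasure μ]
    (η : ℕ → Ω → ℤ) (hη : KChain μ (Pker w) η 0) :
    ∃ γ > (0 : ℝ),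
      (∑' n : ℕ, ENNReal.ofReal (Real.exp (γ * n)) *
          μ {ω | 1 ≤ n ∧ η n ω = 0 ∧ ∀ m, 1 ≤ m → m < n → η m ω ≠ 0}) +
        ⊤ * μ {ω | ∀ n, 1 ≤ n → η n ω ≠ 0} < ⊤ := by
  obtain ⟨s, hs, f, hf, hsup⟩ := exists_supersolution hw
  have hs0 : 0 < s := by linarith
  have hP := tsum_Pker_le hw.1 hs0 (fun x => by linarith [hf x]) hsup
  have hstart : μ {ω | η 0 ω ≠ 0} = 0 := by
    have h1 : μ {ω | ∀ i ≤ 0, η i ω = (fun _ => 0 : ℕ → ℤ) i} = 1 := by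
      rw [hη.2]; simp
    have h2 : {ω | η 0 ω ≠ 0} = {ω | ∀ i ≤ 0, η i ω = (fun _ => 0 : ℕ → ℤ) i}ᶜ := by
      ext ω; simp
    rw [h2, prob_compl_eq_zero_iff, h1]
    simp only [Nat.le_zero, forall_eq]
    exact hη.1 0 (measurableSet_singleton 0)
  have htail : ∀ k : ℕ, μ {ω | ∀ m, 0 < m → m ≤ k → η m ω ≠ 0} ≤
      ENNReal.ofReal (f 0 / s ^ k) := by
    intro k
    have h := measure_avoid_le hη hw.1 hs0 hf hP k 0 (fun _ => 0)
    have hsub : {ω | ∀ m, 0 < m → m ≤ k → η m ω ≠ 0} ⊆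
        {ω | (∀ i ≤ 0, η i ω = (fun _ => 0 : ℕ → ℤ) i) ∧
          ∀ m, 0 < m → m ≤ 0 + k → η m ω ≠ 0} ∪ {ω | η 0 ω ≠ 0} := by
      intro ω hω
      by_cases h0 : η 0 ω = 0
      · exact Or.inl ⟨by simpa using h0, by simpa using hω⟩
      · exact Or.inr h0
    calc _ ≤ _ := measure_mono hsub
      _ ≤ _ := measure_union_le _ _
      _ ≤ _ := by
        rw [hstart, add_zero]
        exact h.trans (mul_le_of_le_one_left' prob_le_one)
  have hlim : Tendsto (fun k : ℕ => ENNReal.ofReal (f 0 / s ^ k)) atTop (nhds 0) := by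
    rw [← ENNReal.ofReal_zero]
    refine ENNReal.tendsto_ofReal ?_
    exact tendsto_const_nhds.div_atTop (tendsto_pow_atTop_atTop_of_one_lt hs)
  have hnever : μ {ω | ∀ n, 1 ≤ n → η n ω ≠ 0} = 0 := by
    refine le_antisymm (ge_of_tendsto' hlim fun k => ?_) zero_le
    refine (measure_mono ?_).trans (htail k)
    exact fun ω h m hm _ => h m hm
  refine ⟨Real.log s / 2, by have := Real.log_pos hs; linarith, ?_⟩
  rw [hnever, mul_zero, add_zero]
  set b : ℝ := Real.exp (-(Real.log s / 2)) with hb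
  have hb1 : b < 1 := Real.exp_lt_one_iff.2 (by have := Real.log_pos hs; linarith)
  have hb0 : 0 ≤ b := (Real.exp_pos _).le
  have hbs : ∀ n : ℕ, Real.exp (Real.log s / 2 * n) / s ^ n = b ^ n := fun n => by
    rw [hb, ← Real.exp_nat_mul, ← Real.exp_log hs0, ← Real.exp_nat_mul, ← Real.exp_sub,
      Real.log_exp]
    congr 1
    ring
  have hterm : ∀ n : ℕ, ENNReal.ofReal (Real.exp (Real.log s / 2 * n)) *
      μ {ω | 1 ≤ n ∧ η n ω = 0 ∧ ∀ m, 1 ≤ m → m < n → η m ω ≠ 0} ≤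
        ENNReal.ofReal (f 0 * s * b ^ n) := by
    rintro (_ | n)
    · simp
    · calc _ ≤ ENNReal.ofReal (Real.exp (Real.log s / 2 * (n + 1 : ℕ))) *
            ENNReal.ofReal (f 0 / s ^ n) := by
            gcongr
            exact (measure_mono fun ω h m hm hm' => h.2.2 m hm (by omega)).trans (htail n)
        _ = _ := by
            rw [← ENNReal.ofReal_mul (Real.exp_pos _).le, ← hbs]
            congr 1
            rw [pow_succ]
            field_simp
  refine (ENNReal.tsum_le_tsum hterm).trans_lt ?_
  exact (Summable.mul_left _ (summable_geometric_of_lt_one hb0 hb1)).tsum_ofReal_lt_top
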